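/- arXiv:2106.06246 — 2 statements merged into one kernel-verified Lean document; each statement's English description precedes it below -/
import Mathlib

section
/- Let n be a positive integer and let B be a real symmetric 2n×2n matrix. If the nullity of B is odd, or the Morse index of B is odd, then the matrix J·B is linearly unstable, i.e., it is not the case that J·B is both spectrally stable and diagonalizable over ℂ. -/
open Matrix

noncomputable section

/-- The standard symplectic matrix `J = [[0, -Iₙ], [Iₙ, 0]]`. -/
def Jmat (n : ℕ) : Matrix (Fin n ⊕ Fin n) (Fin n ⊕ Fin n) ℝ :=
  Matrix.fromBlocks 0 (-1) 1 0

/-- A real matrix regarded as a complex matrix. -/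
def mapC {m : Type*} [Fintype m] [DecidableEq m] (M : Matrix m m ℝ) : Matrix m m ℂ :=
  M.map (algebraMap ℝ ℂ)

/-- `M` is spectrally stable if every complex eigenvalue of `M` is purely imaginary. -/
def spectrallyStable {m : Type*} [Fintype m] [DecidableEq m] (M : Matrix m m ℝ) : Prop :=
  ∀ z ∈ spectrum ℂ (mapC M), z.re = 0

/-- `M` is semisimple if it is diagonalizable over `ℂ`. -/
def semisimpleC {m : Type*} [Fintype m] [DecidableEq m] (M : Matrix m m ℝ) : Prop :=
  ∃ P : Matrix m m ℂ, IsUnit P ∧ ∃ d : m → ℂ, mapC M = P * Matrix.diagonal d * P⁻¹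

/-- The Morse index of a real symmetric matrix: the number of negative eigenvalues,
counted with multiplicity (as roots of the characteristic polynomial). -/
def morseIndex {m : Type*} [Fintype m] [DecidableEq m] (B : Matrix m m ℝ) : ℕ :=
  ((B.charpoly.roots).filter (fun x => x < 0)).card

/-- The nullity of a real matrix: the dimension of its kernel. -/
def nullity {m : Type*} [Fintype m] [DecidableEq m] (B : Matrix m m ℝ) : ℕ :=
  Module.finrank ℝ (LinearMap.ker B.mulVecLin)

section LinearStability

variable {m : Type*} [Fintype m]

lemma dotProduct_mulVec_self_of_skew {S : Matrix m m ℝ} (hS : Sᵀ = -S) (x : m → ℝ) :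
    x ⬝ᵥ S *ᵥ x = 0 := by
  have h : x ⬝ᵥ S *ᵥ x = -(x ⬝ᵥ S *ᵥ x) := by
    conv_lhs => rw [Matrix.dotProduct_mulVec, ← Matrix.mulVec_transpose, hS, Matrix.neg_mulVec,
      neg_dotProduct, dotProduct_comm]
  linarith

lemma even_card_of_prod_pos (f : m → ℝ) (h : 0 < ∏ i, f i) :
    Even (Finset.univ.filter fun i => f i < 0).card := by
  have h1 : ∏ i, f i = (-1) ^ (Finset.univ.filter fun i => f i < 0).card * ∏ i, |f i| := by
    rw [← Finset.prod_const, Finset.prod_filter, ← Finset.prod_mul_distrib]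
    refine Finset.prod_congr rfl fun i _ => ?_
    split_ifs with hi
    · rw [abs_of_neg hi]; ring
    · rw [abs_of_nonneg (not_lt.mp hi), one_mul]
  by_contra hodd
  rw [Nat.not_even_iff_odd] at hodd
  rw [hodd.neg_one_pow] at h1
  have h2 : 0 ≤ ∏ i, |f i| := Finset.prod_nonneg fun i _ => abs_nonneg _
  linarith

variable [DecidableEq m]

lemma det_ne_zero_of_mulVec {M : Matrix m m ℝ} (h : ∀ x, M *ᵥ x = 0 → x = 0) : M.det ≠ 0 := by
  intro h0
  obtain ⟨x, hx, hMx⟩ := Matrix.exists_mulVec_eq_zero_iff.mpr h0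
  exact hx (h x hMx)

lemma eq_zero_of_det_ne_zero {M : Matrix m m ℝ} (h : M.det ≠ 0) {x : m → ℝ}
    (hx : M *ᵥ x = 0) : x = 0 := by
  by_contra hne
  exact h (Matrix.exists_mulVec_eq_zero_iff.mp ⟨x, hne, hx⟩)

/-- Along a path of invertible real matrices the sign of the determinant is constant. -/
lemma det_pos_of_path {M : ℝ → Matrix m m ℝ} (hM : Continuous M)
    (hne : ∀ r ∈ Set.Icc (0 : ℝ) 1, (M r).det ≠ 0) (h0 : 0 < (M 0).det) : 0 < (M 1).det := by
  by_contra! h1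
  have hc : ContinuousOn (fun r => (M r).det) (Set.Icc 0 1) := hM.matrix_det.continuousOn
  obtain ⟨r, hr, hr0⟩ := intermediate_value_Icc' zero_le_one hc ⟨h1, h0.le⟩
  exact hne r hr hr0

/-- If `A` has no positive real eigenvalue, then `t - A` has positive determinant for `t > 0`. -/
lemma det_smul_one_sub_pos {A : Matrix m m ℝ}
    (hA : ∀ c : ℝ, c ≠ 0 → (c • (1 : Matrix m m ℝ) - A).det ≠ 0) {t : ℝ} (ht : 0 < t) :
    0 < (t • (1 : Matrix m m ℝ) - A).det := by
  have key := det_pos_of_path (M := fun r : ℝ => t • (1 : Matrix m m ℝ) - r • A) (by fun_prop)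
    (fun r _ => ?_) (by simp [ht])
  · simpa using key
  · rcases eq_or_ne r 0 with rfl | hr
    · simp [ht.ne']
    · have e : t • (1 : Matrix m m ℝ) - r • A = r • ((t / r) • (1 : Matrix m m ℝ) - A) := by
        rw [smul_sub, smul_smul, mul_div_cancel₀ _ hr]
      rw [e, Matrix.det_smul]
      exact mul_ne_zero (pow_ne_zero _ hr) (hA _ (div_ne_zero ht.ne' hr))

/-- Let `P` be the projection onto the kernel of `B` and `G` the pseudo-inverse of `B`. If `J B`
is stable and semisimple, then compressing `J` to the kernel of `B` gives a form of positive
determinant. -/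
lemma det_add_compression_pos {J B P G : Matrix m m ℝ}
    (hJ2 : J * J = -1) (hJdet : J.det = 1)
    (hP2 : P * P = P) (hBP : B * P = 0) (hPB : P * B = 0)
    (hGB : G * B = 1 - P) (hBG : B * G = 1 - P)
    (hA : ∀ c : ℝ, c ≠ 0 → (c • (1 : Matrix m m ℝ) - J * B).det ≠ 0)
    (hss : ∀ x, (J * B) *ᵥ (J * B) *ᵥ x = 0 → (J * B) *ᵥ x = 0) :
    0 < (B + P * J * P).det := by
  have hne : (B + P * J * P).det ≠ 0 := by
    apply det_ne_zero_of_mulVec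
    intro x hx
    have h1 : P *ᵥ (B + P * J * P) *ᵥ x = 0 := by rw [hx, Matrix.mulVec_zero]
    have e1 : P * (B + P * J * P) = P * J * P := by
      rw [mul_add, hPB, zero_add, mul_assoc P J P, ← mul_assoc P P, hP2]
    rw [Matrix.mulVec_mulVec, e1] at h1
    have hB : B *ᵥ x = 0 := by rwa [Matrix.add_mulVec, h1, add_zero] at hx
    have hPx : P *ᵥ x = x := by
      have : (1 - P) *ᵥ x = 0 := by rw [← hGB, ← Matrix.mulVec_mulVec, hB, Matrix.mulVec_zero]
      rw [Matrix.sub_mulVec, Matrix.one_mulVec, sub_eq_zero] at this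
      exact this.symm
    rw [← Matrix.mulVec_mulVec, hPx, ← Matrix.mulVec_mulVec] at h1
    have h2 : B *ᵥ G *ᵥ J *ᵥ x = J *ᵥ x := by
      rw [Matrix.mulVec_mulVec, hBG, Matrix.sub_mulVec, h1, Matrix.one_mulVec, sub_zero]
    have h3 : (J * B) *ᵥ G *ᵥ J *ᵥ x = -x := by
      rw [← Matrix.mulVec_mulVec, h2, Matrix.mulVec_mulVec, hJ2, Matrix.neg_mulVec,
        Matrix.one_mulVec]
    have h4 := hss (G *ᵥ J *ᵥ x) (by
      rw [h3, ← Matrix.mulVec_mulVec, Matrix.mulVec_neg, hB, neg_zero, Matrix.mulVec_zero])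
    rw [h3] at h4
    exact neg_eq_zero.mp h4
  have hpert : ∀ t : ℝ, t ≠ 0 → 0 ≤ (B + t ^ 2 • J).det := by
    intro t ht
    have e : B + t ^ 2 • J = J * (t ^ 2 • (1 : Matrix m m ℝ) - J * B) := by
      rw [mul_sub, ← mul_assoc, hJ2, Matrix.mul_smul, mul_one, neg_one_mul]
      abel
    rw [e, Matrix.det_mul, hJdet, one_mul]
    exact (det_smul_one_sub_pos hA (by positivity)).le
  let C : ℝ → Matrix m m ℝ := fun t => t • (1 - P) + P
  have hCB : ∀ t, C t * B = t • B := fun t => by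
    simp only [C, add_mul, Matrix.smul_mul, sub_mul, hPB, one_mul, sub_zero, add_zero]
  have hBC : ∀ t, B * C t = t • B := fun t => by
    simp only [C, mul_add, Matrix.mul_smul, mul_sub, hBP, mul_one, sub_zero, add_zero]
  have hscaled : ∀ t : ℝ, t ≠ 0 → 0 ≤ (B + C t * J * C t).det := by
    intro t ht
    have e : t ^ 2 • (B + C t * J * C t) = C t * (B + t ^ 2 • J) * C t := by
      have hCt := hCB t
      have htC := hBC t
      generalize C t = X at hCt htC
      rw [mul_add, add_mul, hCt, Matrix.smul_mul, htC, smul_smul, Matrix.mul_smul,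
        Matrix.smul_mul, smul_add, pow_two]
    have e2 := congrArg Matrix.det e
    rw [Matrix.det_smul, Matrix.det_mul, Matrix.det_mul] at e2
    have h1 : 0 < (t ^ 2) ^ Fintype.card m := by positivity
    have h2 : 0 ≤ (t ^ 2) ^ Fintype.card m * (B + C t * J * C t).det := by
      rw [e2]
      nlinarith [mul_nonneg (hpert t ht) (mul_self_nonneg (C t).det)]
    exact nonneg_of_mul_nonneg_right h2 h1
  have hcont : Continuous fun t => (B + C t * J * C t).det := by
    apply Continuous.matrix_det
    fun_prop
  have hnonneg : 0 ≤ (B + C 0 * J * C 0).det := by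
    refine ge_of_tendsto (x := nhdsWithin (0 : ℝ) {0}ᶜ)
      ((hcont.tendsto 0).mono_left nhdsWithin_le_nhds) ?_
    filter_upwards [self_mem_nhdsWithin] with t ht using hscaled t ht
  have hC0 : C 0 = P := by simp [C]
  rw [hC0] at hnonneg
  exact lt_of_le_of_ne hnonneg hne.symm

lemma det_add_proj_pos {J B P G : Matrix m m ℝ} (hJ : Jᵀ = -J) (hPt : Pᵀ = P)
    (hP2 : P * P = P) (hPB : P * B = 0) (hGB : G * B = 1 - P)
    (hpos : 0 < (B + P * J * P).det) : 0 < (B + P).det := by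
  have key := det_pos_of_path (M := fun r : ℝ => B + r • P + (1 - r) • (P * J * P))
    (by fun_prop) (fun r hr => ?_) (by simpa using hpos)
  · simpa using key
  · rcases eq_or_ne r 0 with rfl | hr0
    · simpa using hpos.ne'
    apply det_ne_zero_of_mulVec
    intro x hx
    have hskew : (P * J * P)ᵀ = -(P * J * P) := by
      rw [Matrix.transpose_mul, Matrix.transpose_mul, hPt, hJ]
      simp [mul_assoc]
    have h1 : P *ᵥ (B + r • P + (1 - r) • (P * J * P)) *ᵥ x = 0 := by
      rw [hx, Matrix.mulVec_zero]
    have e1 : P * (B + r • P + (1 - r) • (P * J * P)) = r • P + (1 - r) • (P * J * P) := by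
      rw [mul_add, mul_add, hPB, zero_add, Matrix.mul_smul, Matrix.mul_smul, hP2,
        mul_assoc P J P, ← mul_assoc P P, hP2]
    rw [Matrix.mulVec_mulVec, e1] at h1
    have h2 := congrArg (fun v => x ⬝ᵥ v) h1
    simp only [Matrix.add_mulVec, dotProduct_add, Matrix.smul_mulVec, dotProduct_smul,
      dotProduct_mulVec_self_of_skew hskew, smul_zero, add_zero, dotProduct_zero] at h2
    have h3 : x ⬝ᵥ P *ᵥ x = 0 := by simpa [hr0] using h2
    have hPx : P *ᵥ x = 0 := by
      rw [← hP2, ← Matrix.mulVec_mulVec, Matrix.dotProduct_mulVec, ← Matrix.mulVec_transpose,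
        hPt] at h3
      exact dotProduct_self_eq_zero.mp h3
    have hB : B *ᵥ x = 0 := by
      rw [add_assoc, Matrix.add_mulVec, h1, add_zero] at hx
      exact hx
    have : (1 - P) *ᵥ x = 0 := by rw [← hGB, ← Matrix.mulVec_mulVec, hB, Matrix.mulVec_zero]
    rwa [Matrix.sub_mulVec, Matrix.one_mulVec, hPx, sub_zero] at this

lemma det_reflection_eq_one {J B P : Matrix m m ℝ} (hJ : Jᵀ = -J) (hB : Bᵀ = B) (hPt : Pᵀ = P)
    (hP2 : P * P = P) (hBP : B * P = 0) (hpos : 0 < (B + P * J * P).det) :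
    (1 - (2 : ℝ) • P).det = 1 := by
  have e : (B + P * J * P)ᵀ = (B + P * J * P) * (1 - (2 : ℝ) • P) := by
    rw [Matrix.transpose_add, Matrix.transpose_mul, Matrix.transpose_mul, hPt, hJ, hB, mul_sub,
      mul_one, Matrix.mul_smul, add_mul, hBP, zero_add, mul_assoc (P * J), hP2, two_smul]
    simp only [mul_assoc, neg_mul, mul_neg]
    abel
  have h := congrArg Matrix.det e
  rw [Matrix.det_transpose, Matrix.det_mul] at h
  exact (mul_left_cancel₀ hpos.ne' (by rw [mul_one]; exact h)).symm

lemma det_smul_one_sub_ne_zero_of_spectrallyStable {A : Matrix m m ℝ} (h : spectrallyStable A)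
    {c : ℝ} (hc : c ≠ 0) : (c • (1 : Matrix m m ℝ) - A).det ≠ 0 := by
  intro h0
  refine hc (h (c : ℂ) ?_)
  rw [spectrum.mem_iff, Matrix.isUnit_iff_isUnit_det]
  have e : algebraMap ℂ (Matrix m m ℂ) (c : ℂ) - mapC A
      = (algebraMap ℝ ℂ).mapMatrix (c • (1 : Matrix m m ℝ) - A) := by
    ext i j
    by_cases hij : i = j <;> simp [mapC, Matrix.algebraMap_matrix_apply, hij]
  rw [e, ← RingHom.map_det, h0]
  simp

lemma mulVec_eq_zero_of_semisimpleC {A : Matrix m m ℝ} (h : semisimpleC A) {x : m → ℝ}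
    (hx : A *ᵥ A *ᵥ x = 0) : A *ᵥ x = 0 := by
  obtain ⟨P, hP, d, hd⟩ := h
  have hdet := (Matrix.isUnit_iff_isUnit_det P).mp hP
  have hmap : ∀ y : m → ℝ, mapC A *ᵥ (fun i => (y i : ℂ)) = fun i => ((A *ᵥ y) i : ℂ) := by
    intro y
    ext i
    simp [mapC, Matrix.mulVec, dotProduct]
  set v : m → ℂ := fun i => (x i : ℂ) with hv
  have h2 : mapC A *ᵥ mapC A *ᵥ v = 0 := by
    rw [hv, hmap, hmap, hx]
    ext i
    simp
  set w := P⁻¹ *ᵥ v with hw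
  have e2 : mapC A * mapC A = P * (Matrix.diagonal d * Matrix.diagonal d) * P⁻¹ := by
    rw [hd]
    calc _ = P * Matrix.diagonal d * (P⁻¹ * P) * Matrix.diagonal d * P⁻¹ := by
          simp only [mul_assoc]
      _ = _ := by rw [Matrix.nonsing_inv_mul _ hdet, mul_one]; simp only [mul_assoc]
  have h3 : (Matrix.diagonal d * Matrix.diagonal d) *ᵥ w = 0 := by
    have := congrArg (fun u => P⁻¹ *ᵥ u) h2
    simp only [Matrix.mulVec_mulVec, Matrix.mulVec_zero, e2] at this
    rwa [← mul_assoc, ← mul_assoc, Matrix.nonsing_inv_mul _ hdet, one_mul,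
      ← Matrix.mulVec_mulVec] at this
  have h4 : Matrix.diagonal d *ᵥ w = 0 := by
    ext i
    have := congrFun h3 i
    rw [Matrix.diagonal_mul_diagonal, Matrix.mulVec_diagonal] at this
    rw [Matrix.mulVec_diagonal]
    simpa using this
  have h5 : mapC A *ᵥ v = 0 := by
    rw [hd, ← Matrix.mulVec_mulVec, ← Matrix.mulVec_mulVec, ← hw, h4, Matrix.mulVec_zero]
  rw [hv, hmap] at h5
  ext i
  simpa using congrFun h5 i

lemma nullity_eq_card {B : Matrix m m ℝ} (hB : B.IsHermitian) :
    nullity B = (Finset.univ.filter fun i => hB.eigenvalues i = 0).card := by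
  have h1 := B.mulVecLin.finrank_range_add_finrank_ker
  have h2 := hB.rank_eq_card_non_zero_eigs
  rw [Fintype.card_subtype] at h2
  have h3 := Finset.card_filter_add_card_filter_not (s := (Finset.univ : Finset m))
    (fun i => hB.eigenvalues i = 0)
  simp only [Module.finrank_fintype_fun_eq_card, Finset.card_univ] at h1 h3
  unfold nullity
  unfold Matrix.rank at h2
  simp only [ne_eq] at h2
  omega

lemma morseIndex_eq_card {B : Matrix m m ℝ} (hB : B.IsHermitian) :
    morseIndex B = (Finset.univ.filter fun i => hB.eigenvalues i < 0).card := by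
  unfold morseIndex
  rw [hB.roots_charpoly_eq_eigenvalues, Multiset.filter_map, Multiset.card_map]
  rfl

/-- Parity of nullity and Morse index for a linearly stable system, for an arbitrary orthogonal
complex structure `J` of determinant one. -/
theorem even_nullity_and_even_morseIndex {J B : Matrix m m ℝ} (hJ : Jᵀ = -J)
    (hJ2 : J * J = -1) (hJdet : J.det = 1) (hB : B.IsSymm)
    (hst : spectrallyStable (J * B)) (hss : semisimpleC (J * B)) :
    Even (nullity B) ∧ Even (morseIndex B) := by
  have hH : B.IsHermitian := by
    rw [Matrix.IsHermitian, Matrix.conjTranspose_eq_transpose_of_trivial]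
    exact hB
  set U : Matrix m m ℝ := (hH.eigenvectorUnitary : Matrix m m ℝ) with hU
  have hUU : Uᵀ * U = 1 := by
    have := Unitary.coe_star_mul_self hH.eigenvectorUnitary
    rwa [Matrix.star_eq_conjTranspose, Matrix.conjTranspose_eq_transpose_of_trivial] at this
  have hUU' : U * Uᵀ = 1 := mul_eq_one_comm.mp hUU
  let F : (m → ℝ) → Matrix m m ℝ := fun f => U * Matrix.diagonal f * Uᵀ
  have hFmul : ∀ f g, F f * F g = F (fun i => f i * g i) := by
    intro f g
    calc F f * F g = U * Matrix.diagonal f * (Uᵀ * U) * Matrix.diagonal g * Uᵀ := by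
          simp only [F, mul_assoc]
      _ = _ := by
        rw [hUU, mul_one, mul_assoc U, Matrix.diagonal_mul_diagonal]
  have hFt : ∀ f, (F f)ᵀ = F f := fun f => by
    simp only [F, Matrix.transpose_mul, Matrix.transpose_transpose, Matrix.diagonal_transpose,
      mul_assoc]
  have hFadd : ∀ f g, F f + F g = F (fun i => f i + g i) := fun f g => by
    simp only [F, ← Matrix.diagonal_add, mul_add, add_mul]
  have hFsmul : ∀ (c : ℝ) f, c • F f = F (fun i => c * f i) := fun c f => by
    have : Matrix.diagonal (fun i => c * f i) = c • Matrix.diagonal f := by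
      rw [← Matrix.diagonal_smul]; rfl
    simp only [F, this, Matrix.mul_smul, Matrix.smul_mul]
  have hF0 : F (fun _ => 0) = 0 := by simp [F]
  have hF1 : F (fun _ => 1) = 1 := by simp [F, hUU']
  have hFdet : ∀ f, (F f).det = ∏ i, f i := fun f => by
    simp only [F]
    rw [Matrix.det_mul_right_comm, hUU', one_mul, Matrix.det_diagonal]
  set l := hH.eigenvalues with hl
  have hBF : B = F l := by
    have := hH.spectral_theorem
    rw [Unitary.conjStarAlgAut_apply, Matrix.star_eq_conjTranspose,
      Matrix.conjTranspose_eq_transpose_of_trivial] at this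
    exact this
  let p : m → ℝ := fun i => if l i = 0 then 1 else 0
  have hP2 : F p * F p = F p := by
    rw [hFmul]; congr 1; ext i; simp [p]
  have hBP : B * F p = 0 := by
    rw [hBF, hFmul, ← hF0]; congr 1; ext i; simp [p]
  have hPB : F p * B = 0 := by
    rw [hBF, hFmul, ← hF0]; congr 1; ext i; simp [p]
  have hsub : (1 : Matrix m m ℝ) - F p = F (fun i => if l i = 0 then 0 else 1) := by
    rw [sub_eq_iff_eq_add, hFadd, ← hF1]; congr 1; ext i; by_cases h : l i = 0 <;> simp [p, h]
  have hGB : F (fun i => (l i)⁻¹) * B = 1 - F p := by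
    rw [hsub, hBF, hFmul]; congr 1; ext i; by_cases h : l i = 0 <;> simp [h]
  have hBG : B * F (fun i => (l i)⁻¹) = 1 - F p := by
    rw [hsub, hBF, hFmul]; congr 1; ext i; by_cases h : l i = 0 <;> simp [h]
  have hpos := det_add_compression_pos hJ2 hJdet hP2 hBP hPB hGB hBG
    (fun c hc => det_smul_one_sub_ne_zero_of_spectrallyStable hst hc)
    (fun x hx => mulVec_eq_zero_of_semisimpleC hss hx)
  constructor
  · have h1 := det_reflection_eq_one hJ hB (hFt p) hP2 hBP hpos
    have e : (1 : Matrix m m ℝ) - (2 : ℝ) • F p = F (fun i => if l i = 0 then -1 else 1) := by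
      rw [sub_eq_iff_eq_add, hFsmul, hFadd, ← hF1]
      congr 1; ext i; by_cases h : l i = 0 <;> simp [p, h]; norm_num
    rw [e, hFdet] at h1
    have h2 := even_card_of_prod_pos _ (h1 ▸ one_pos)
    rw [nullity_eq_card hH]
    convert h2 using 3 with i
    by_cases h : l i = 0 <;> simp [← hl, h]
  · have h1 := det_add_proj_pos hJ (hFt p) hP2 hPB hGB hpos
    rw [hBF, hFadd, hFdet] at h1
    have h2 := even_card_of_prod_pos _ h1
    rw [morseIndex_eq_card hH]
    convert h2 using 3 with i
    by_cases h : l i = 0 <;> simp [← hl, p, h]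

end LinearStability

/-- If a real symmetric `2n × 2n` matrix `B` has odd nullity or odd Morse index,
then `J·B` is linearly unstable: it is not both spectrally stable and
diagonalizable over `ℂ`. -/
theorem stmt_0 (n : ℕ) (hn : 0 < n)
    (B : Matrix (Fin n ⊕ Fin n) (Fin n ⊕ Fin n) ℝ) (hB : B.IsSymm)
    (h : Odd (nullity B) ∨ Odd (morseIndex B)) :
    ¬ (spectrallyStable (Jmat n * B) ∧ semisimpleC (Jmat n * B)) := by
  rintro ⟨hst, hss⟩
  have hJ : Jmat n = Matrix.J (Fin n) ℝ := rfl
  have key := even_nullity_and_even_morseIndex (J := Jmat n)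
    (by rw [hJ, Matrix.J_transpose]) (by rw [hJ, Matrix.J_squared])
    (by rw [hJ]; exact SymplecticGroup.det_eq_one (SymplecticGroup.J_mem _ _)) hB hst hss
  rcases h with h | h
  · exact Nat.not_even_iff_odd.mpr h key.1
  · exact Nat.not_even_iff_odd.mpr h key.2
end
end

section
/- Let n be a positive integer, let Ω be an invertible real skew-symmetric 2n×2n matrix, and let B be a real symmetric 2n×2n matrix. If the nullity of B is odd, or the Morse index of B is odd, then the matrix Ω·B is linearly unstable, i.e., it is not the case that Ω·B is both spectrally stable and diagonalizable over ℂ. -/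
open Matrix

noncomputable section

/-- A real matrix joined to the identity by a segment of invertible matrices has positive
determinant. -/
theorem det_pos_of_segment {m : Type*} [Fintype m] [DecidableEq m] (G : Matrix m m ℝ)
    (h : ∀ t ∈ Set.Icc (0 : ℝ) 1, ((1 - t) • G + t • (1 : Matrix m m ℝ)).det ≠ 0) :
    0 < G.det := by
  by_contra! hG
  have hcont : Continuous fun t : ℝ => ((1 - t) • G + t • (1 : Matrix m m ℝ)).det :=
    Continuous.matrix_det (by fun_prop)
  obtain ⟨t, ht, h0⟩ := intermediate_value_Icc zero_le_one hcont.continuousOn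
    (show (0 : ℝ) ∈ Set.Icc _ _ by simp [hG])
  exact h t ht h0

theorem det_mul_diagonal_mul_inv {m : Type*} [Fintype m] [DecidableEq m] {P : Matrix m m ℂ}
    (hP : IsUnit P) (e : m → ℂ) : (P * diagonal e * P⁻¹).det = ∏ i, e i := by
  rw [det_conj hP, det_diagonal]

/-- A real matrix, diagonalizable over `ℂ`, whose eigenvalues are nonzero with nonnegative real
part, has positive determinant. -/
theorem det_pos_of_diagonalizable {m : Type*} [Fintype m] [DecidableEq m] {G : Matrix m m ℝ}
    {P : Matrix m m ℂ} (hP : IsUnit P) {e : m → ℂ} (hG : mapC G = P * diagonal e * P⁻¹)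
    (hre : ∀ i, 0 ≤ (e i).re) (hne : ∀ i, e i ≠ 0) : 0 < G.det := by
  refine det_pos_of_segment G fun t ht h0 => ?_
  have hPP : P * P⁻¹ = 1 := mul_nonsing_inv P ((isUnit_iff_isUnit_det P).1 hP)
  have key : mapC ((1 - t) • G + t • (1 : Matrix m m ℝ)) =
      P * diagonal (fun i => (1 - t : ℂ) * e i + t) * P⁻¹ := by
    have h1 : mapC ((1 - t) • G + t • (1 : Matrix m m ℝ)) =
        (1 - t : ℂ) • mapC G + (t : ℂ) • 1 := by
      ext i j
      by_cases hij : i = j <;> simp [mapC, hij]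
    have h2 : diagonal (fun i => (1 - t : ℂ) * e i + t) =
        (1 - t : ℂ) • diagonal e + (t : ℂ) • (1 : Matrix m m ℂ) := by
      ext i j
      by_cases hij : i = j <;> simp [hij]
    rw [h1, h2, hG, mul_add, add_mul]
    simp [hPP]
  have hdet : (mapC ((1 - t) • G + t • (1 : Matrix m m ℝ))).det = 0 := by
    have := RingHom.map_det (algebraMap ℝ ℂ) ((1 - t) • G + t • (1 : Matrix m m ℝ))
    rw [h0, map_zero] at this
    exact this.symm
  rw [key, det_mul_diagonal_mul_inv hP, Finset.prod_eq_zero_iff] at hdet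
  obtain ⟨i, -, hi⟩ := hdet
  have hi' : (1 - t) * (e i).re + t = 0 := by
    have := congrArg Complex.re hi
    simpa using this
  have ht0 : t = 0 := by
    have := mul_nonneg (sub_nonneg.2 ht.2) (hre i)
    linarith [ht.1]
  exact hne i (by simpa [ht0] using hi)

theorem det_skew_add_gram_pos {m : Type*} [Fintype m] [DecidableEq m] {S Q : Matrix m m ℝ}
    (hS : Sᵀ = -S) (h : (S + Qᵀ * Q).det ≠ 0) : 0 < (S + Qᵀ * Q).det := by
  refine det_pos_of_segment _ fun t ht h0 => ?_
  rcases eq_or_lt_of_le ht.1 with rfl | htpos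
  · simp [h] at h0
  obtain ⟨v, hv, hv0⟩ := exists_mulVec_eq_zero_iff.2 h0
  have hskew : v ⬝ᵥ S *ᵥ v = 0 := by
    have : v ⬝ᵥ S *ᵥ v = -(v ⬝ᵥ S *ᵥ v) := by
      conv_lhs => rw [dotProduct_mulVec, ← mulVec_transpose, hS, neg_mulVec, neg_dotProduct,
        dotProduct_comm]
    linarith
  have hgram : v ⬝ᵥ (Qᵀ * Q) *ᵥ v = Q *ᵥ v ⬝ᵥ Q *ᵥ v := by
    rw [← mulVec_mulVec, dotProduct_mulVec, vecMul_transpose]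
  have hquad := congrArg (v ⬝ᵥ ·) hv0
  simp only [add_mulVec, smul_mulVec, dotProduct_add, dotProduct_smul, hskew, hgram, one_mulVec,
    dotProduct_zero, smul_eq_mul] at hquad
  have hpos : 0 < v ⬝ᵥ v := by
    refine lt_of_le_of_ne (Finset.sum_nonneg fun i _ => mul_self_nonneg _) fun h' => hv ?_
    exact dotProduct_self_eq_zero.1 h'.symm
  have hnn : 0 ≤ Q *ᵥ v ⬝ᵥ Q *ᵥ v := Finset.sum_nonneg fun i _ => mul_self_nonneg _
  nlinarith [mul_pos htpos hpos, mul_nonneg (sub_nonneg.2 ht.2) hnn]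

theorem map_re_mul_mapC {m : Type*} [Fintype m] [DecidableEq m] (A : Matrix m m ℂ)
    (M : Matrix m m ℝ) : (A * mapC M).map Complex.re = A.map Complex.re * M := by
  ext i j
  simp [mapC, mul_apply, Complex.re_sum]

theorem map_re_mapC_mul {m : Type*} [Fintype m] [DecidableEq m] (A : Matrix m m ℂ)
    (M : Matrix m m ℝ) : (mapC M * A).map Complex.re = M * A.map Complex.re := by
  ext i j
  simp [mapC, mul_apply, Complex.re_sum]

theorem mapC_mul {m : Type*} [Fintype m] [DecidableEq m] (A B : Matrix m m ℝ) :
    mapC (A * B) = mapC A * mapC B :=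
  Matrix.map_mul

/-- The spectral projection onto the kernel of a linearly stable matrix. -/
theorem exists_kernel_projection {m : Type*} [Fintype m] [DecidableEq m] {M : Matrix m m ℝ}
    (hs : spectrallyStable M) (hd : semisimpleC M) :
    ∃ Z N : Matrix m m ℝ, M * Z = 0 ∧ Z * M = 0 ∧ 1 - Z = N * M ∧
      ∀ c : ℝ, c ≠ 0 → 0 < (c • M + Z).det := by
  obtain ⟨P, hP, d, hM⟩ := hd
  have hdetP := (isUnit_iff_isUnit_det P).1 hP
  have hPP : P * P⁻¹ = 1 := mul_nonsing_inv P hdetP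
  have hPP' : P⁻¹ * P = 1 := nonsing_inv_mul P hdetP
  have hconj (a b : m → ℂ) : (P * diagonal a * P⁻¹) * (P * diagonal b * P⁻¹) =
      P * diagonal (fun i => a i * b i) * P⁻¹ := by
    rw [← diagonal_mul_diagonal]
    simp only [Matrix.mul_assoc]
    rw [← Matrix.mul_assoc P⁻¹ P, hPP', Matrix.one_mul]
  have hre : ∀ i, (d i).re = 0 := by
    refine fun i => hs _ ?_
    have hspec : spectrum ℂ (mapC M) = spectrum ℂ (diagonal d) := by
      rw [hM]
      obtain ⟨u, rfl⟩ := hP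
      rw [← coe_units_inv]
      exact spectrum.units_conjugate
    rw [hspec, spectrum_diagonal]
    exact ⟨i, rfl⟩
  set z : m → ℂ := fun i => if d i = 0 then 1 else 0 with hz
  set Zc := P * diagonal z * P⁻¹ with hZc
  set Nc := P * diagonal (fun i => (d i)⁻¹) * P⁻¹ with hNc
  have hdz : ∀ i, d i * z i = 0 := fun i => by by_cases h : d i = 0 <;> simp [hz, h]
  have hone : ∀ i, (d i)⁻¹ * d i + z i = 1 := fun i => by
    by_cases h : d i = 0 <;> simp [hz, h]
  have hMZ : mapC M * Zc = 0 := by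
    rw [hM, hZc, hconj]
    simp [hdz]
  have hZM : Zc * mapC M = 0 := by
    rw [hM, hZc, hconj]
    simp [mul_comm (z _), hdz]
  have hNM : Nc * mapC M + Zc = 1 := by
    rw [hM, hZc, hNc, hconj, ← add_mul, ← mul_add, diagonal_add]
    simp [hone, hPP]
  have hMN : mapC M * Nc + Zc = 1 := by
    rw [hM, hZc, hNc, hconj, ← add_mul, ← mul_add, diagonal_add]
    simp [mul_comm (d _), hone, hPP]
  have hre0 : (0 : Matrix m m ℂ).map Complex.re = 0 := by ext; simp
  have hMZ' : M * Zc.map Complex.re = 0 := by rw [← map_re_mapC_mul, hMZ, hre0]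
  have hZM' : Zc.map Complex.re * M = 0 := by rw [← map_re_mul_mapC, hZM, hre0]
  have hNM' : Nc.map Complex.re * M + Zc.map Complex.re = 1 := by
    rw [← map_re_mul_mapC]
    rw [← Matrix.map_add _ Complex.add_re, hNM]
    exact Matrix.map_one _ Complex.zero_re Complex.one_re
  have hmapZ : mapC (Zc.map Complex.re) = Zc := by
    have h0 : mapC (0 : Matrix m m ℝ) = 0 := by ext; simp [mapC]
    have h1 : mapC (Zc.map Complex.re) * mapC M = 0 := by rw [← mapC_mul, hZM', h0]
    have h2 : mapC (Nc.map Complex.re) * mapC M + mapC (Zc.map Complex.re) = 1 := by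
      rw [← mapC_mul]
      have := congrArg mapC hNM'
      ext i j
      have := congrFun (congrFun this i) j
      obtain rfl | h := eq_or_ne i j <;> simpa [mapC, *] using this
    calc mapC (Zc.map Complex.re) = mapC (Zc.map Complex.re) * (mapC M * Nc + Zc) := by
          rw [hMN, mul_one]
      _ = (mapC (Nc.map Complex.re) * mapC M + mapC (Zc.map Complex.re)) * Zc := by
          rw [mul_add, add_mul, ← mul_assoc, h1, mul_assoc, hMZ]
          simp
      _ = Zc := by rw [h2, one_mul]
  refine ⟨Zc.map Complex.re, Nc.map Complex.re, hMZ', hZM', by rw [← hNM']; abel,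
    fun c hc => ?_⟩
  refine det_pos_of_diagonalizable hP (e := fun i => c * d i + z i) ?_ ?_ ?_
  · have h1 : mapC (c • M + Zc.map Complex.re) = (c : ℂ) • mapC M + Zc := by
      rw [← hmapZ]
      ext i j
      simp [mapC]
    have h2 : diagonal (fun i => c * d i + z i) = (c : ℂ) • diagonal d + diagonal z := by
      ext i j
      by_cases hij : i = j <;> simp [hij]
    rw [h1, h2, hM, hZc, mul_add, add_mul]
    simp
  · intro i
    by_cases h : d i = 0 <;> simp [hz, h, hre]
  · intro i
    by_cases h : d i = 0 <;> simp [hz, h, hc]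

/-- Orthogonal projection `E` onto the kernel of a symmetric matrix `B`; the determinants of
`1 - 2E` and `B + E` detect the parities of the nullity and of the Morse index. -/
theorem exists_orthogonal_kernel_projection {m : Type*} [Fintype m] [DecidableEq m]
    {B : Matrix m m ℝ} (hB : B.IsSymm) :
    ∃ E N : Matrix m m ℝ, B * E = 0 ∧ Eᵀ = E ∧ 1 - E = N * B ∧
      (1 - 2 • E).det = (-1) ^ nullity B ∧ (B + E).det ≠ 0 ∧
      (0 < (B + E).det → Even (morseIndex B)) := by
  have hH : B.IsHermitian := by
    rw [IsHermitian, conjTranspose_eq_transpose_of_trivial]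
    exact hB
  set l := hH.eigenvalues
  set U : Matrix m m ℝ := ↑hH.eigenvectorUnitary
  have hUU' : Uᵀ * U = 1 := by
    have := Unitary.coe_star_mul_self hH.eigenvectorUnitary
    simpa [star_eq_conjTranspose, conjTranspose_eq_transpose_of_trivial] using this
  have hUU : U * Uᵀ = 1 := mul_eq_one_comm.1 hUU'
  have hBU : B = U * diagonal l * Uᵀ := by
    have := hH.spectral_theorem
    rw [Unitary.conjStarAlgAut_apply] at this
    simpa [star_eq_conjTranspose, conjTranspose_eq_transpose_of_trivial] using this
  have hconj (a b : m → ℝ) : (U * diagonal a * Uᵀ) * (U * diagonal b * Uᵀ) =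
      U * diagonal (fun i => a i * b i) * Uᵀ := by
    rw [← diagonal_mul_diagonal]
    simp only [Matrix.mul_assoc]
    rw [← Matrix.mul_assoc Uᵀ U, hUU', Matrix.one_mul]
  have hdet (a : m → ℝ) : (U * diagonal a * Uᵀ).det = ∏ i, a i := by
    rw [det_mul_right_comm, hUU, one_mul, det_diagonal]
  set z : m → ℝ := fun i => if l i = 0 then 1 else 0 with hz
  have hsum : B + U * diagonal z * Uᵀ = U * diagonal (fun i => l i + z i) * Uᵀ := by
    rw [hBU, ← diagonal_add, mul_add, add_mul]
  have hne : ∀ i, l i + z i ≠ 0 := fun i => by by_cases h : l i = 0 <;> simp [hz, h]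
  refine ⟨U * diagonal z * Uᵀ, U * diagonal (fun i => (l i)⁻¹) * Uᵀ, ?_, ?_, ?_, ?_, ?_, ?_⟩
  · rw [hBU, hconj]
    have : (fun i => l i * z i) = 0 := by
      ext i
      by_cases h : l i = 0 <;> simp [hz, h]
    simp [this]
  · simp [Matrix.mul_assoc]
  · rw [hBU, hconj, sub_eq_iff_eq_add, ← add_mul, ← mul_add, diagonal_add]
    have : (fun i => (l i)⁻¹ * l i + z i) = 1 := by
      ext i
      by_cases h : l i = 0 <;> simp [hz, h]
    rw [this]
    simp [hUU]
  · have h1 : 1 - 2 • (U * diagonal z * Uᵀ) = U * diagonal (fun i => 1 - 2 * z i) * Uᵀ := by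
      have : diagonal (fun i => 1 - 2 * z i) = 1 - 2 • diagonal z := by
        rw [two_smul]
        ext i j
        by_cases hij : i = j <;> simp [hij, two_mul]
      rw [this, mul_sub, sub_mul, mul_smul_comm, smul_mul_assoc, mul_one, hUU]
    have h2 : nullity B = Fintype.card {i // l i = 0} := by
      have hr := hH.rank_eq_card_non_zero_eigs
      have hrn := LinearMap.finrank_range_add_finrank_ker B.mulVecLin
      have hc := Fintype.card_subtype_compl (fun i => l i = 0)
      have hle := Fintype.card_subtype_le (fun i => l i = 0)
      simp only [Module.finrank_fintype_fun_eq_card] at hrn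
      change B.rank + nullity B = _ at hrn
      change B.rank = Fintype.card {i // ¬ l i = 0} at hr
      omega
    have h3 : ∀ i, 1 - 2 * z i = if l i = 0 then -1 else 1 := fun i => by
      by_cases h : l i = 0 <;> simp [hz, h]; norm_num
    rw [h1, hdet, h2, Fintype.card_subtype]
    simp only [h3]
    rw [Finset.prod_ite]
    simp
  · rw [hsum, hdet]
    exact Finset.prod_ne_zero_iff.2 fun i _ => hne i
  · rw [hsum, hdet]
    intro hpos
    have hm : morseIndex B = (Finset.univ.filter fun i => l i < 0).card := by
      rw [morseIndex, hH.roots_charpoly_eq_eigenvalues, Multiset.filter_map, Multiset.card_map]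
      rfl
    by_contra hodd
    rw [Nat.not_even_iff_odd, hm] at hodd
    have hprod : ∏ i, (l i + z i) =
        (∏ i, |l i + z i|) * ∏ i, (if l i < 0 then (-1 : ℝ) else 1) := by
      rw [← Finset.prod_mul_distrib]
      refine Finset.prod_congr rfl fun i _ => ?_
      rcases lt_trichotomy (l i) 0 with h | h | h
      · simp [hz, h, h.ne, abs_of_neg h]
      · simp [hz, h]
      · simp [hz, h.not_gt, h.ne', abs_of_pos h]
    rw [hprod, Finset.prod_ite] at hpos
    simp only [Finset.prod_const, one_pow, hodd.neg_one_pow] at hpos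
    have : 0 ≤ ∏ i, |l i + z i| := Finset.prod_nonneg fun i _ => abs_nonneg _
    linarith

/-- If `Ω` is an invertible real skew-symmetric matrix and the real symmetric matrix `B`
has odd nullity or odd Morse index, then `Ω·B` is linearly unstable: it is not both
spectrally stable and diagonalizable over `ℂ`. -/
theorem stmt_1 (n : ℕ) (hn : 0 < n)
    (Ω B : Matrix (Fin n ⊕ Fin n) (Fin n ⊕ Fin n) ℝ)
    (hΩskew : Ωᵀ = -Ω) (hΩinv : IsUnit Ω.det) (hB : B.IsSymm)
    (h : Odd (nullity B) ∨ Odd (morseIndex B)) :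
    ¬ (spectrallyStable (Ω * B) ∧ semisimpleC (Ω * B)) := by
  rintro ⟨hs, hd⟩
  obtain ⟨Z, N, hMZ, hZM, hNM, hpos⟩ := exists_kernel_projection hs hd
  obtain ⟨E, L, hBE, hE, hLB, hnull, hBEdet, hmorse⟩ := exists_orthogonal_kernel_projection hB
  have hBZ : B * Z = 0 := by
    rw [← nonsing_inv_mul_cancel_left Ω (B * Z) hΩinv, ← Matrix.mul_assoc Ω, hMZ, Matrix.mul_zero]
  have hEZ : E * Z = Z := by
    have : (1 - E) * Z = 0 := by rw [hLB, Matrix.mul_assoc, hBZ, Matrix.mul_zero]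
    rw [sub_mul, one_mul, sub_eq_zero] at this
    exact this.symm
  have hZE : Z * E = E := by
    have : (1 - Z) * E = 0 := by simp [hNM, Matrix.mul_assoc, hBE]
    rw [sub_mul, one_mul, sub_eq_zero] at this
    exact this.symm
  have hZZ : Z * Z = Z := by
    nth_rewrite 2 [← hEZ]
    rw [← mul_assoc, hZE, hEZ]
  have hEE : E * E = E := by
    nth_rewrite 2 [← hZE]
    rw [← mul_assoc, hEZ, hZE]
  have hVW : (1 - E + Z) * (1 - Z + E) = 1 := by
    simp only [mul_add, add_mul, mul_sub, sub_mul, one_mul, mul_one, hEZ, hZE, hZZ, hEE]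
    abel
  have hVdet : (1 - E + Z).det ≠ 0 := fun h0 => by
    have := congrArg det hVW
    simp [h0] at this
  have hdet := hpos 1 one_ne_zero
  rw [one_smul] at hdet
  rcases h with h | h
  · have hconj : (1 - E + Z) * (1 - 2 • Z) = (1 - 2 • E) * (1 - E + Z) := by
      simp only [mul_add, add_mul, mul_sub, sub_mul, one_mul, mul_one, mul_smul_comm,
        smul_mul_assoc, hEZ, hZZ, hEE]
      abel
    have hrefl : (1 - 2 • Z).det = -1 := by
      have := congrArg det hconj
      rw [det_mul, det_mul, mul_comm] at this
      rw [mul_right_cancel₀ hVdet this, hnull, h.neg_one_pow]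
    have hprod : (Ω * B + Z) * (1 - 2 • Z) = -((-1 : ℝ) • (Ω * B) + Z) := by
      simp only [mul_sub, add_mul, mul_one, mul_smul_comm, hMZ, hZZ, neg_smul, one_smul]
      abel
    have hneg := hpos (-1) (by norm_num)
    have := congrArg det hprod
    rw [det_mul, hrefl, det_neg, Fintype.card_sum, Even.neg_one_pow ⟨_, rfl⟩] at this
    linarith
  · have hBV : (1 - E + Z)ᵀ * (B + E) * (1 - E + Z) = B + Zᵀ * Z := by
      have hEB : E * B = 0 := by simpa [hE, hB.eq] using congrArg transpose hBE
      have hZB : Zᵀ * B = 0 := by simpa [hB.eq] using congrArg transpose hBZ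
      have hZEt : E * Zᵀ = E := by simpa [hE] using congrArg transpose hZE
      have hEZt : Zᵀ * E = Zᵀ := by simpa [hE] using congrArg transpose hEZ
      simp only [transpose_add, transpose_sub, transpose_one, hE, mul_add, add_mul, mul_sub,
        sub_mul, one_mul, mul_one, hEB, hZB, hBE, hBZ, hEE, hEZ, hEZt]
      abel
    have hacc : (Ω * B + Z)ᵀ * (B + Zᵀ * Z) = (Ω * B)ᵀ * B + Zᵀ * Z := by
      have h1 : (Ω * B)ᵀ * Zᵀ = 0 := by rw [← transpose_mul, hZM, transpose_zero]
      have h2 : Zᵀ * B = 0 := by simpa [hB.eq] using congrArg transpose hBZ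
      have h3 : Zᵀ * Zᵀ = Zᵀ := by rw [← transpose_mul, hZZ]
      rw [transpose_add, mul_add, add_mul, add_mul, ← mul_assoc, h1, h2, ← mul_assoc, h3]
      simp
    have hskew : ((Ω * B)ᵀ * B)ᵀ = -((Ω * B)ᵀ * B) := by
      simp [transpose_mul, hB.eq, hΩskew, mul_assoc]
    have heq : ((Ω * B)ᵀ * B + Zᵀ * Z).det =
        (Ω * B + Z).det * ((1 - E + Z).det ^ 2 * (B + E).det) := by
      rw [← hacc, ← hBV, det_mul, det_mul, det_mul, det_transpose, det_transpose]
      ring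
    have hV2 : 0 < (1 - E + Z).det ^ 2 := by positivity
    have hfin := det_skew_add_gram_pos (Q := Z) hskew (by rw [heq]; positivity)
    rw [heq] at hfin
    have := pos_of_mul_pos_right (pos_of_mul_pos_right hfin hdet.le) hV2.le
    exact Nat.not_even_iff_odd.2 h (hmorse this)
end
end
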